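/- For the star $K_{1,n-1}$ on $n$ vertices, the mean $\mu_n=\sum_i \frac{1}{1+\lambda_i}$ and variance $\sigma_n^2=\sum_i\frac{\lambda_i}{(1+\lambda_i)^2}$ associated to its Laplacian eigenvalues $\lambda_i$ satisfy $\mu_n=\frac{n^2+n+2}{2(n+1)}$ and $\sigma_n^2=\frac{(n-1)(n^2+n+2)}{4(n+1)^2}$; consequently $\sigma_n\to\infty$ and the Laplacian coefficients $c(K_{1,n-1},k)$ are asymptotically normal by central and local limit theorems with this mean and variance. -/

import Mathlib

open Filter Finset Polynomial
open scoped Classical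

theorem lapMatrix_completeBipartiteGraph_fin_one (r : ℕ) :
    (completeBipartiteGraph (Fin 1) (Fin r)).lapMatrix ℝ =
      Matrix.fromBlocks (.of fun _ _ => (r : ℝ)) (.of fun _ _ => -1) (.of fun _ _ => -1) 1 := by
  have hdeg : ∀ v, ((completeBipartiteGraph (Fin 1) (Fin r)).degree v : ℝ) =
      Sum.elim (fun _ => (r : ℝ)) (fun _ => 1) v := by
    intro v
    rw [SimpleGraph.degree_eq_sum_if_adj, Fintype.sum_sum_type]
    rcases v with v | v <;> simp
  ext i j
  rw [SimpleGraph.lapMatrix, SimpleGraph.degMatrix, Matrix.sub_apply, Matrix.diagonal_apply, hdeg,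
    SimpleGraph.adjMatrix_apply]
  rcases i with i | i <;> rcases j with j | j
  · simp [Subsingleton.elim i j]
  · simp
  · simp
  · simp [Matrix.one_apply]

theorem charpoly_lapMatrix_star (m : ℕ) :
    ((completeBipartiteGraph (Fin 1) (Fin (m + 1))).lapMatrix ℝ).charpoly =
      X * (X - C ((m : ℝ) + 2)) * (X - C 1) ^ m := by
  apply Polynomial.eq_of_infinite_eval_eq
  refine Set.Infinite.mono ?_ (Set.finite_singleton (1 : ℝ)).infinite_compl
  intro x hx
  have hx1 : x - 1 ≠ 0 := sub_ne_zero.2 (by simpa using hx)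
  have hdiag : (Matrix.scalar (Fin (m + 1)) x - 1 : Matrix _ _ ℝ) =
      Matrix.diagonal fun _ => x - 1 := by
    ext i j
    by_cases h : i = j <;> simp [h]
  have hblock : Matrix.scalar (Fin 1 ⊕ Fin (m + 1)) x -
      Matrix.fromBlocks (.of fun _ _ => ((m + 1 : ℕ) : ℝ)) (.of fun _ _ => -1)
        (.of fun _ _ => -1) 1 =
      Matrix.fromBlocks (.of fun _ _ => x - ((m + 1 : ℕ) : ℝ)) (.of fun _ _ => 1) (.of fun _ _ => 1)
        (Matrix.diagonal fun _ : Fin (m + 1) => x - 1) := by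
    rw [← hdiag]
    ext i j
    rcases i with i | i <;> rcases j with j | j <;> simp [Matrix.diagonal_apply]
    exact fun h => absurd (Subsingleton.elim i j) h
  let : Invertible (Matrix.diagonal fun _ : Fin (m + 1) => x - 1) :=
    ⟨Matrix.diagonal fun _ => (x - 1)⁻¹, by simp [hx1], by simp [hx1]⟩
  have hinv : ⅟(Matrix.diagonal fun _ : Fin (m + 1) => x - 1) =
    Matrix.diagonal fun _ => (x - 1)⁻¹ := rfl
  rw [Set.mem_ofPred_eq, Matrix.eval_charpoly, lapMatrix_completeBipartiteGraph_fin_one, hblock,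
    Matrix.det_fromBlocks₂₂, hinv]
  simp [Matrix.mul_apply, Matrix.diagonal_apply]
  field_simp
  ring

theorem sum_eq_of_prod_X_sub_C_eq {ι : Type*} [Fintype ι] (lam : ι → ℝ) (a : ℝ) (m : ℕ)
    (h : ∏ i, (X - C (lam i)) = X * (X - C a) * (X - C 1) ^ m) (f : ℝ → ℝ) :
    ∑ i, f (lam i) = f 0 + f a + m * f 1 := by
  have hl : (Finset.univ.val.map lam) = {0, a} + Multiset.replicate m (1 : ℝ) := by
    have h2 := congrArg Polynomial.roots h
    have hne : (X * (X - C a) * (X - C 1) ^ m : ℝ[X]) ≠ 0 :=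
      mul_ne_zero (mul_ne_zero X_ne_zero (X_sub_C_ne_zero _)) (pow_ne_zero _ (X_sub_C_ne_zero _))
    rw [roots_mul hne, roots_mul (left_ne_zero_of_mul hne), roots_X, roots_X_sub_C, roots_pow,
      roots_X_sub_C, Multiset.nsmul_singleton] at h2
    rw [← Polynomial.roots_multiset_prod_X_sub_C (Finset.univ.val.map lam), Multiset.map_map]
    exact h2
  calc ∑ i, f (lam i) = ((Finset.univ.val.map lam).map f).sum := by
        rw [Multiset.map_map]; rfl
    _ = _ := by rw [hl]; simp [add_assoc]

/-- The coefficient of a polynomial at an arbitrary integer, zero at the negative ones. -/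
noncomputable def intCoeff {R : Type*} [Semiring R] (P : R[X]) (k : ℤ) : R :=
  if 0 ≤ k then P.coeff k.toNat else 0

/-- The standard normal density. -/
noncomputable def stdNormalDensity (x : ℝ) : ℝ :=
  (Real.sqrt (2 * Real.pi))⁻¹ * Real.exp (-x ^ 2 / 2)

/-- The characteristic function of `(Z - μ) / σ`, where `Z` has generating polynomial `Q`. -/
noncomputable def standardizedCharFun (Q : ℝ[X]) (μ σ s : ℝ) : ℂ :=
  Complex.exp (-(μ * (s / σ : ℝ) * Complex.I)) *
    (Q.map Complex.ofRealHom).eval (Complex.exp ((s / σ : ℝ) * Complex.I))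

theorem continuous_standardizedCharFun (Q : ℝ[X]) (μ σ : ℝ) :
    Continuous (standardizedCharFun Q μ σ) := by
  unfold standardizedCharFun
  refine Continuous.mul (by fun_prop) ((Polynomial.continuous _).comp ?_)
  fun_prop

theorem integral_exp_int_mul_I (k : ℤ) :
    ∫ t in (-Real.pi)..Real.pi, Complex.exp (k * t * Complex.I) =
      if k = 0 then 2 * (Real.pi : ℂ) else 0 := by
  split_ifs with hk
  · subst hk
    simp
    ring
  · have hc : (k * Complex.I : ℂ) ≠ 0 :=
      mul_ne_zero (by exact_mod_cast hk) Complex.I_ne_zero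
    have h := integral_exp_mul_complex (a := -Real.pi) (b := Real.pi) hc
    have hper : Complex.exp (k * Complex.I * (Real.pi : ℝ)) =
        Complex.exp (k * Complex.I * ((-Real.pi : ℝ) : ℂ)) := by
      rw [Complex.exp_eq_exp_iff_exists_int]
      exact ⟨k, by push_cast; ring⟩
    rw [hper, sub_self, zero_div] at h
    rw [← h]
    congr 1
    ext t
    ring_nf

theorem integral_exp_mul_eval_exp (P : ℂ[X]) (k : ℤ) :
    ∫ t in (-Real.pi)..Real.pi, Complex.exp (-(k * t * Complex.I)) *
      P.eval (Complex.exp (t * Complex.I)) = 2 * Real.pi * intCoeff P k := by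
  have hc : ∀ P : ℂ[X], Continuous fun t : ℝ => Complex.exp (-(k * t * Complex.I)) *
      P.eval (Complex.exp (t * Complex.I)) := fun P =>
    Continuous.mul (by fun_prop) ((Polynomial.continuous P).comp (by fun_prop))
  induction P using Polynomial.induction_on' with
  | add p q hp hq =>
    simp only [eval_add, mul_add]
    rw [intervalIntegral.integral_add ((hc p).intervalIntegrable _ _)
      ((hc q).intervalIntegrable _ _), hp, hq]
    unfold intCoeff
    split_ifs <;> simp [mul_add]
  | monomial n a =>
    have : ∀ t : ℝ, Complex.exp (-(k * t * Complex.I)) *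
        (monomial n a).eval (Complex.exp (t * Complex.I)) =
        a * Complex.exp (((n - k : ℤ) : ℂ) * t * Complex.I) := by
      intro t
      rw [eval_monomial, ← Complex.exp_nat_mul, mul_left_comm, ← Complex.exp_add]
      push_cast
      ring_nf
    simp only [this]
    rw [intervalIntegral.integral_const_mul, integral_exp_int_mul_I, intCoeff, coeff_monomial]
    by_cases hk : 0 ≤ k
    · have : ((n : ℤ) - k = 0) ↔ n = k.toNat := by omega
      simp only [this, hk, if_true]
      split_ifs <;> ring
    · have : ¬ ((n : ℤ) - k = 0) := by omega
      simp [this, hk]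

theorem mul_intCoeff_eq_integral (Q : ℝ[X]) (μ σ : ℝ) (hσ : 0 < σ) (k : ℤ) :
    ((σ * intCoeff Q k : ℝ) : ℂ) = (2 * Real.pi : ℂ)⁻¹ *
      ∫ s in (-(Real.pi * σ))..(Real.pi * σ),
        Complex.exp (-(((k - μ) / σ : ℝ) * s * Complex.I)) * standardizedCharFun Q μ σ s := by
  have h := integral_exp_mul_eval_exp (Q.map Complex.ofRealHom) k
  have hco : intCoeff (Q.map Complex.ofRealHom) k = ((intCoeff Q k : ℝ) : ℂ) := by
    unfold intCoeff
    split_ifs <;> simp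
  have hchange := intervalIntegral.integral_comp_div (a := -(Real.pi * σ)) (b := Real.pi * σ)
    (fun t : ℝ => Complex.exp (-(k * t * Complex.I)) *
      (Q.map Complex.ofRealHom).eval (Complex.exp (t * Complex.I))) hσ.ne'
  rw [neg_div, mul_div_cancel_right₀ _ hσ.ne', h, hco] at hchange
  have hint : ∀ s : ℝ, Complex.exp (-(((k - μ) / σ : ℝ) * s * Complex.I)) *
      standardizedCharFun Q μ σ s = Complex.exp (-(k * (s / σ : ℝ) * Complex.I)) *
      (Q.map Complex.ofRealHom).eval (Complex.exp ((s / σ : ℝ) * Complex.I)) := by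
    intro s
    rw [standardizedCharFun, ← mul_assoc, ← Complex.exp_add]
    congr 2
    push_cast
    ring
  simp only [hint]
  rw [hchange]
  have : (Real.pi : ℂ) ≠ 0 := by exact_mod_cast Real.pi_ne_zero
  push_cast
  rw [Complex.real_smul]
  field_simp

theorem integrable_exp_neg_sq_div_two : MeasureTheory.Integrable fun s : ℝ =>
    Real.exp (-s ^ 2 / 2) := by
  convert integrable_exp_neg_mul_sq (b := 1 / 2) (by norm_num) using 2 with s
  ring_nf

theorem stdNormalDensity_eq_integral (y : ℝ) :
    (stdNormalDensity y : ℂ) = (2 * Real.pi : ℂ)⁻¹ *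
      ∫ s : ℝ, Complex.exp (-(y * s * Complex.I)) * (Real.exp (-s ^ 2 / 2) : ℝ) := by
  have h := fourierIntegral_gaussian (b := 1 / 2) (by norm_num) (-y : ℂ)
  have hint : ∀ s : ℝ, Complex.exp (-(y * s * Complex.I)) * (Real.exp (-s ^ 2 / 2) : ℝ) =
      Complex.exp (Complex.I * (-y) * s) * Complex.exp (-(1 / 2) * s ^ 2) := by
    intro s
    push_cast
    ring_nf
  simp only [hint]
  have hs : ((Real.pi : ℂ) / (1 / 2)) ^ (1 / 2 : ℂ) = ((Real.sqrt (2 * Real.pi) : ℝ) : ℂ) := by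
    rw [Real.sqrt_eq_rpow, Complex.ofReal_cpow (by positivity)]
    push_cast
    ring_nf
  rw [h, hs, stdNormalDensity]
  have hsq : ((Real.sqrt (2 * Real.pi) : ℝ) : ℂ) * ((Real.sqrt (2 * Real.pi) : ℝ) : ℂ) =
      2 * Real.pi := by
    rw [← Complex.ofReal_mul, Real.mul_self_sqrt (by positivity)]
    push_cast
    ring
  have hne : ((Real.sqrt (2 * Real.pi) : ℝ) : ℂ) ≠ 0 := by
    exact_mod_cast (Real.sqrt_pos.2 (by positivity)).ne'
  have he : Complex.exp (-(-(y : ℂ)) ^ 2 / (4 * (1 / 2))) = ((Real.exp (-y ^ 2 / 2) : ℝ) : ℂ) := by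
    push_cast
    ring_nf
  rw [he, ← hsq]
  push_cast
  field_simp

theorem abs_mul_intCoeff_sub_le (Q : ℝ[X]) (μ σ : ℝ) (hσ : 0 < σ) (k : ℤ) :
    |σ * intCoeff Q k - stdNormalDensity ((k - μ) / σ)| ≤ (2 * Real.pi)⁻¹ *
      ∫ s : ℝ, ‖(Set.Ioc (-(Real.pi * σ)) (Real.pi * σ)).indicator (standardizedCharFun Q μ σ) s -
        (Real.exp (-s ^ 2 / 2) : ℝ)‖ := by
  set S := Set.Ioc (-(Real.pi * σ)) (Real.pi * σ)
  set y := (k - μ) / σ with hy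
  have hle : -(Real.pi * σ) ≤ Real.pi * σ := by
    have : 0 < Real.pi * σ := by positivity
    linarith
  have h1 := mul_intCoeff_eq_integral Q μ σ hσ k
  rw [intervalIntegral.integral_of_le hle, ← MeasureTheory.integral_indicator measurableSet_Ioc]
    at h1
  have hi1 : MeasureTheory.Integrable (S.indicator fun s : ℝ =>
      Complex.exp (-(y * s * Complex.I)) * standardizedCharFun Q μ σ s) := by
    rw [MeasureTheory.integrable_indicator_iff measurableSet_Ioc]
    refine (Continuous.integrableOn_Icc ?_).mono_set Set.Ioc_subset_Icc_self
    exact Continuous.mul (by fun_prop) (continuous_standardizedCharFun Q μ σ)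
  have hnorm : ∀ s : ℝ, ‖Complex.exp (-(y * s * Complex.I))‖ = 1 := by
    intro s
    have : -((y : ℂ) * s * Complex.I) = ((-(y * s) : ℝ) : ℂ) * Complex.I := by push_cast; ring
    rw [this, Complex.norm_exp_ofReal_mul_I]
  have hi2 : MeasureTheory.Integrable fun s : ℝ =>
      Complex.exp (-(y * s * Complex.I)) * (Real.exp (-s ^ 2 / 2) : ℝ) := by
    refine integrable_exp_neg_sq_div_two.mono' (Continuous.aestronglyMeasurable (by fun_prop)) ?_
    refine Filter.Eventually.of_forall fun s => ?_
    rw [norm_mul, hnorm, one_mul, Complex.norm_real, Real.norm_of_nonneg (Real.exp_pos _).le]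
  rw [← Real.norm_eq_abs, ← Complex.norm_real, Complex.ofReal_sub, h1,
    stdNormalDensity_eq_integral, ← mul_sub, ← MeasureTheory.integral_sub hi1 hi2, norm_mul]
  have hpi : ‖(2 * Real.pi : ℂ)⁻¹‖ = (2 * Real.pi)⁻¹ := by
    rw [norm_inv, norm_mul, Complex.norm_real, Real.norm_of_nonneg Real.pi_pos.le]
    simp
  rw [hpi]
  gcongr
  refine (MeasureTheory.norm_integral_le_integral_norm _).trans_eq ?_
  congr 1
  ext s
  rw [Set.indicator_mul_right, ← mul_sub, norm_mul, hnorm, one_mul]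

theorem abs_stdNormalDensity_sub_le (x y : ℝ) :
    |stdNormalDensity x - stdNormalDensity y| ≤ |x - y| := by
  have hd : ∀ x : ℝ, HasDerivAt stdNormalDensity
      ((Real.sqrt (2 * Real.pi))⁻¹ * (Real.exp (-x ^ 2 / 2) * (-x))) x := by
    intro x
    have : HasDerivAt (fun x : ℝ => -x ^ 2 / 2) (-x) x :=
      ((hasDerivAt_pow 2 x).neg.div_const 2).congr_deriv (by norm_num; ring)
    exact this.exp.const_mul _
  have hsq : 1 ≤ Real.sqrt (2 * Real.pi) := by
    rw [Real.one_le_sqrt]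
    linarith [Real.pi_gt_three]
  have := Convex.norm_image_sub_le_of_norm_deriv_le (f := stdNormalDensity) (C := 1)
    (s := Set.univ) (x := y) (y := x) (fun z _ => (hd z).differentiableAt) (fun z _ => ?_)
    convex_univ trivial trivial
  · simpa using this
  · rw [(hd z).deriv, norm_mul, norm_mul, norm_neg, Real.norm_of_nonneg (Real.exp_pos _).le,
      Real.norm_of_nonneg (by positivity)]
    have h1 : Real.exp (-z ^ 2 / 2) * ‖z‖ ≤ 1 := by
      have h2 : ‖z‖ ≤ Real.exp (z ^ 2 / 2) := by
        refine le_trans ?_ (Real.add_one_le_exp _)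
        rw [Real.norm_eq_abs]
        nlinarith [sq_nonneg (|z| - 1), sq_abs z]
      have h3 : Real.exp (-z ^ 2 / 2) * Real.exp (z ^ 2 / 2) = 1 := by
        rw [← Real.exp_add]
        simp [neg_div]
      rw [← h3]
      gcongr
    exact mul_le_one₀ (inv_le_one_of_one_le₀ hsq) (by positivity) h1

/-- A local limit theorem with a uniform error, from dominated convergence of the standardized
characteristic functions. -/
theorem exists_local_limit_error (Q : ℕ → ℝ[X]) (μ σ : ℕ → ℝ) (hσ : Tendsto σ atTop atTop)
    (hlim : ∀ s : ℝ, Tendsto (fun n => standardizedCharFun (Q n) (μ n) (σ n) s) atTop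
      (nhds (Real.exp (-s ^ 2 / 2) : ℝ)))
    (G : ℝ → ℝ) (hG : MeasureTheory.Integrable G)
    (hbound : ∀ᶠ n in atTop, ∀ s : ℝ, |s| ≤ Real.pi * σ n →
      ‖standardizedCharFun (Q n) (μ n) (σ n) s‖ ≤ G s) (hG0 : ∀ s, 0 ≤ G s) :
    ∃ E : ℕ → ℝ, Tendsto E atTop (nhds 0) ∧ ∀ᶠ n in atTop, ∀ x : ℝ,
      |σ n * intCoeff (Q n) ⌊μ n + x * σ n⌋ - stdNormalDensity x| ≤ E n := by
  set F : ℕ → ℝ → ℝ := fun n s =>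
    ‖(Set.Ioc (-(Real.pi * σ n)) (Real.pi * σ n)).indicator
      (standardizedCharFun (Q n) (μ n) (σ n)) s - (Real.exp (-s ^ 2 / 2) : ℝ)‖ with hF
  have hF0 : Tendsto (fun n => ∫ s, F n s) atTop (nhds (∫ _ : ℝ, (0 : ℝ))) := by
    refine MeasureTheory.tendsto_integral_filter_of_dominated_convergence
      (fun s => G s + Real.exp (-s ^ 2 / 2)) ?_ ?_ (hG.add integrable_exp_neg_sq_div_two) ?_
    · refine Filter.Eventually.of_forall fun n => ?_
      refine ((((continuous_standardizedCharFun _ _ _).measurable.indicator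
        measurableSet_Ioc).sub ?_).norm).aestronglyMeasurable
      exact Continuous.measurable (by fun_prop)
    · filter_upwards [hbound] with n hn
      refine Filter.Eventually.of_forall fun s => ?_
      rw [hF, norm_norm]
      refine (norm_sub_le _ _).trans (add_le_add ?_ ?_)
      · by_cases hs : s ∈ Set.Ioc (-(Real.pi * σ n)) (Real.pi * σ n)
        · rw [Set.indicator_of_mem hs]
          exact hn s (abs_le.2 ⟨hs.1.le, hs.2⟩)
        · rw [Set.indicator_of_notMem hs, norm_zero]
          exact hG0 s
      · rw [Complex.norm_real, Real.norm_of_nonneg (Real.exp_pos _).le]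
    · refine Filter.Eventually.of_forall fun s => ?_
      have h := ((hlim s).sub_const ((Real.exp (-s ^ 2 / 2) : ℝ) : ℂ)).norm
      rw [sub_self, norm_zero] at h
      refine h.congr' ?_
      have hlarge := (hσ.const_mul_atTop Real.pi_pos).eventually_gt_atTop |s|
      filter_upwards [hlarge] with n hn
      have hs : s ∈ Set.Ioc (-(Real.pi * σ n)) (Real.pi * σ n) :=
        ⟨(abs_lt.1 hn).1, (abs_lt.1 hn).2.le⟩
      rw [hF]
      simp only [Set.indicator_of_mem hs]
  rw [MeasureTheory.integral_zero] at hF0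
  refine ⟨fun n => (2 * Real.pi)⁻¹ * (∫ s, F n s) + (σ n)⁻¹, ?_, ?_⟩
  · simpa using (hF0.const_mul _).add hσ.inv_tendsto_atTop
  · filter_upwards [hσ.eventually_gt_atTop 0] with n hn x
    set k := ⌊μ n + x * σ n⌋ with hk
    refine (abs_sub_le _ (stdNormalDensity ((k - μ n) / σ n)) _).trans (add_le_add ?_ ?_)
    · exact abs_mul_intCoeff_sub_le (Q n) (μ n) (σ n) hn k
    · refine (abs_stdNormalDensity_sub_le _ _).trans ?_
      have h1 := Int.floor_le (μ n + x * σ n)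
      have h2 := Int.lt_floor_add_one (μ n + x * σ n)
      rw [← hk] at h1 h2
      have : (k - μ n) / σ n - x = (k - μ n - x * σ n) / σ n := by field_simp
      rw [this, abs_div, abs_of_pos hn, inv_eq_one_div]
      gcongr
      rw [abs_le]
      constructor <;> linarith

theorem integrable_stdNormalDensity : MeasureTheory.Integrable stdNormalDensity :=
  integrable_exp_neg_sq_div_two.const_mul _

theorem stdNormalDensity_nonneg (x : ℝ) : 0 ≤ stdNormalDensity x := by
  unfold stdNormalDensity
  positivity

theorem stdNormalDensity_le_one (x : ℝ) : stdNormalDensity x ≤ 1 := by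
  have hsq : 1 ≤ Real.sqrt (2 * Real.pi) := by
    rw [Real.one_le_sqrt]
    linarith [Real.pi_gt_three]
  refine mul_le_one₀ (inv_le_one_of_one_le₀ hsq) (Real.exp_pos _).le (Real.exp_le_one_iff.2 ?_)
  nlinarith [sq_nonneg x]

theorem integral_stdNormalDensity : ∫ x, stdNormalDensity x = 1 := by
  unfold stdNormalDensity
  rw [MeasureTheory.integral_const_mul]
  have h := integral_gaussian (1 / 2)
  have hint : ∀ x : ℝ, Real.exp (-x ^ 2 / 2) = Real.exp (-(1 / 2) * x ^ 2) := by
    intro x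
    ring_nf
  simp only [hint]
  rw [h, show Real.pi / (1 / 2) = 2 * Real.pi by ring]
  have hne : 0 < Real.sqrt (2 * Real.pi) := Real.sqrt_pos.2 (by positivity)
  exact inv_mul_cancel₀ (ne_of_gt hne)

/-- The Scheffé lemma. -/
theorem tendsto_integral_abs_sub_of_tendsto {α : Type*} [MeasurableSpace α]
    {ν : MeasureTheory.Measure α} (f : ℕ → α → ℝ) (g : α → ℝ)
    (hf : ∀ᶠ n in atTop, MeasureTheory.Integrable (f n) ν) (hf0 : ∀ᶠ n in atTop, ∀ x, 0 ≤ f n x)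
    (hg : MeasureTheory.Integrable g ν) (hg0 : ∀ x, 0 ≤ g x)
    (hfg : ∀ᶠ n in atTop, ∫ x, f n x ∂ν = ∫ x, g x ∂ν)
    (hlim : ∀ x, Tendsto (fun n => f n x) atTop (nhds (g x))) :
    Tendsto (fun n => ∫ x, |f n x - g x| ∂ν) atTop (nhds 0) := by
  have hpos : Tendsto (fun n => ∫ x, max (g x - f n x) 0 ∂ν) atTop
      (nhds (∫ _ : α, (0 : ℝ) ∂ν)) := by
    refine MeasureTheory.tendsto_integral_filter_of_dominated_convergence g ?_ ?_ hg ?_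
    · filter_upwards [hf] with n hn
      exact ((hg.sub hn).pos_part).aestronglyMeasurable
    · filter_upwards [hf0] with n hn
      refine Filter.Eventually.of_forall fun x => ?_
      rw [Real.norm_of_nonneg (le_max_right _ _)]
      exact max_le (by linarith [hn x]) (hg0 x)
    · refine Filter.Eventually.of_forall fun x => ?_
      simpa using ((hlim x).const_sub (g x)).max (tendsto_const_nhds (x := (0 : ℝ)))
  rw [MeasureTheory.integral_zero] at hpos
  have h2 := hpos.const_mul 2
  rw [mul_zero] at h2
  refine h2.congr' ?_
  filter_upwards [hf, hfg] with n hn hn1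
  have habs : ∀ x, |f n x - g x| = 2 * max (g x - f n x) 0 + (f n x - g x) := by
    intro x
    rcases le_total (g x) (f n x) with h | h
    · rw [abs_of_nonneg (by linarith), max_eq_right (by linarith)]
      ring
    · rw [abs_of_nonpos (by linarith), max_eq_left (by linarith)]
      ring
  simp only [habs]
  have hpart : MeasureTheory.Integrable (fun x => 2 * max (g x - f n x) 0) ν :=
    (hg.sub hn).pos_part.const_mul 2
  have hsub : MeasureTheory.Integrable (fun x => f n x - g x) ν := hn.sub hg
  rw [MeasureTheory.integral_add hpart hsub,
    MeasureTheory.integral_sub hn hg, hn1, sub_self, add_zero, MeasureTheory.integral_const_mul]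

/-- The histogram density of `(Z - μ) / σ`, where `Z` has generating polynomial `Q`. -/
noncomputable def histogram (Q : ℝ[X]) (μ σ y : ℝ) : ℝ :=
  σ * intCoeff Q ⌊μ + y * σ⌋

theorem histogram_eq_sum (Q : ℝ[X]) (M : ℕ) (hM : Q.natDegree < M) (μ σ : ℝ) (hσ : 0 < σ) (y : ℝ) :
    histogram Q μ σ y = ∑ j ∈ Finset.range M, Q.coeff j *
      (Set.Ico ((j - μ) / σ) ((j + 1 - μ) / σ)).indicator (fun _ => σ) y := by
  have hmem : ∀ j : ℕ, y ∈ Set.Ico ((j - μ) / σ) ((j + 1 - μ) / σ) ↔ ⌊μ + y * σ⌋ = (j : ℤ) := by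
    intro j
    rw [Int.floor_eq_iff, Set.mem_Ico, div_le_iff₀ hσ, lt_div_iff₀ hσ]
    push_cast
    constructor <;> rintro ⟨h1, h2⟩ <;> constructor <;> linarith
  simp only [Set.indicator_apply, hmem]
  unfold histogram intCoeff
  split_ifs with h
  · obtain ⟨k, hk⟩ := Int.eq_ofNat_of_zero_le h
    rw [hk]
    simp only [Int.toNat_natCast, Nat.cast_inj, mul_ite, mul_zero]
    rw [Finset.sum_ite_eq]
    split_ifs with hkM
    · ring
    · rw [coeff_eq_zero_of_natDegree_lt, mul_zero]
      rw [Finset.mem_range] at hkM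
      omega
  · rw [mul_zero, Finset.sum_eq_zero]
    intro j _
    rw [if_neg (by omega), mul_zero]

theorem integrable_indicator_Ico_const (a b c : ℝ) :
    MeasureTheory.Integrable ((Set.Ico a b).indicator fun _ => c) := by
  rw [MeasureTheory.integrable_indicator_iff measurableSet_Ico]
  exact MeasureTheory.integrableOn_const (by simp)

theorem integrable_histogram (Q : ℝ[X]) (μ σ : ℝ) (hσ : 0 < σ) :
    MeasureTheory.Integrable (histogram Q μ σ) := by
  rw [funext (histogram_eq_sum Q _ (Nat.lt_succ_self _) μ σ hσ)]
  exact MeasureTheory.integrable_finsetSum _ fun j _ =>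
    (integrable_indicator_Ico_const _ _ _).const_mul _

theorem integral_indicator_Ico_of_length_inv (μ σ : ℝ) (hσ : 0 < σ) (j : ℕ) :
    ∫ y, (Set.Ico ((j - μ) / σ) ((j + 1 - μ) / σ)).indicator (fun _ => σ) y = 1 := by
  rw [MeasureTheory.integral_indicator_const _ measurableSet_Ico, Real.volume_real_Ico_of_le]
  · rw [smul_eq_mul]
    field_simp
    ring
  · gcongr
    linarith

theorem integral_histogram (Q : ℝ[X]) (hQ : Q.eval 1 = 1) (μ σ : ℝ) (hσ : 0 < σ) :
    ∫ y, histogram Q μ σ y = 1 := by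
  simp only [histogram_eq_sum Q _ (Nat.lt_succ_self _) μ σ hσ]
  rw [MeasureTheory.integral_finsetSum _ fun j _ =>
    (integrable_indicator_Ico_const _ _ _).const_mul _]
  simp only [MeasureTheory.integral_const_mul, integral_indicator_Ico_of_length_inv μ σ hσ]
  rw [eval_eq_sum_range] at hQ
  simpa using hQ

theorem abs_sum_sub_setIntegral_histogram_le (Q : ℝ[X]) (hQ0 : ∀ j, 0 ≤ Q.coeff j) (M : ℕ)
    (hM : Q.natDegree < M) (μ σ : ℝ) (hσ : 0 < σ) (x : ℝ) :
    |(∑ j ∈ Finset.range M, if (j : ℝ) ≤ μ + x * σ then Q.coeff j else 0) -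
      ∫ y in Set.Iic x, histogram Q μ σ y| ≤ intCoeff Q ⌊μ + x * σ⌋ := by
  have hbin : ∀ j : ℕ, |(if (j : ℝ) ≤ μ + x * σ then Q.coeff j else 0) - Q.coeff j *
      ∫ y in Set.Iic x, (Set.Ico ((j - μ) / σ) ((j + 1 - μ) / σ)).indicator (fun _ => σ) y| ≤
      if ⌊μ + x * σ⌋ = (j : ℤ) then Q.coeff j else 0 := by
    intro j
    have hnn : ∀ y, 0 ≤ (Set.Ico ((j - μ) / σ) ((j + 1 - μ) / σ)).indicator (fun _ => σ) y :=
      fun y => Set.indicator_nonneg (fun _ _ => hσ.le) y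
    rcases lt_trichotomy (j : ℤ) ⌊μ + x * σ⌋ with h | h | h
    · have h1 : ((j : ℝ) + 1) ≤ μ + x * σ := by
        have : ((j : ℤ) + 1 : ℤ) ≤ ⌊μ + x * σ⌋ := h
        exact_mod_cast Int.le_floor.1 this
      rw [MeasureTheory.setIntegral_eq_integral_of_forall_compl_eq_zero,
        integral_indicator_Ico_of_length_inv μ σ hσ, if_pos (by linarith), if_neg h.ne']
      · simp
      · intro y hy
        apply Set.indicator_of_notMem
        rintro ⟨_, h2⟩
        rw [lt_div_iff₀ hσ] at h2
        have : x * σ < y * σ := mul_lt_mul_of_pos_right (not_le.1 hy) hσ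
        linarith
    · have h1 : (j : ℝ) ≤ μ + x * σ := by exact_mod_cast Int.le_floor.1 h.le
      rw [if_pos h1, if_pos h.symm]
      have hle := MeasureTheory.setIntegral_le_integral (s := Set.Iic x)
        (integrable_indicator_Ico_const ((j - μ) / σ) ((j + 1 - μ) / σ) σ)
        (Filter.Eventually.of_forall hnn)
      rw [integral_indicator_Ico_of_length_inv μ σ hσ] at hle
      have hge := MeasureTheory.setIntegral_nonneg (μ := MeasureTheory.volume)
        (measurableSet_Iic (a := x)) fun y _ => hnn y
      rw [abs_le]
      constructor <;> nlinarith [hQ0 j]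
    · have h1 : μ + x * σ < j := by exact_mod_cast Int.floor_lt.1 h
      rw [if_neg (by linarith), if_neg h.ne, MeasureTheory.setIntegral_eq_zero_of_forall_eq_zero]
      · simp
      · intro y hy
        apply Set.indicator_of_notMem
        rintro ⟨h2, _⟩
        rw [div_le_iff₀ hσ] at h2
        have : y * σ ≤ x * σ := mul_le_mul_of_nonneg_right hy hσ.le
        linarith
  simp only [histogram_eq_sum Q M hM μ σ hσ]
  rw [MeasureTheory.integral_finsetSum _ fun j _ =>
    ((integrable_indicator_Ico_const _ _ _).const_mul _).integrableOn]
  simp only [MeasureTheory.integral_const_mul]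
  rw [← Finset.sum_sub_distrib]
  refine (Finset.abs_sum_le_sum_abs _ _).trans ((Finset.sum_le_sum fun j _ => hbin j).trans ?_)
  unfold intCoeff
  split_ifs with h
  · obtain ⟨k, hk⟩ := Int.eq_ofNat_of_zero_le h
    rw [hk]
    simp only [Int.toNat_natCast, Nat.cast_inj]
    rw [Finset.sum_ite_eq]
    split_ifs
    exacts [le_rfl, hQ0 k]
  · refine (Finset.sum_eq_zero fun j _ => ?_).le
    rw [if_neg (by omega)]

/-- A local limit theorem with uniform error implies a central limit theorem with uniform error. -/
theorem exists_central_limit_error (Q : ℕ → ℝ[X]) (M : ℕ → ℕ) (μ σ : ℕ → ℝ)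
    (hσ : Tendsto σ atTop atTop) (hM : ∀ n, (Q n).natDegree < M n)
    (hQ0 : ∀ n j, 0 ≤ (Q n).coeff j) (hQ1 : ∀ n, (Q n).eval 1 = 1)
    (E : ℕ → ℝ) (hE : Tendsto E atTop (nhds 0))
    (hlocal : ∀ᶠ n in atTop, ∀ x : ℝ,
      |σ n * intCoeff (Q n) ⌊μ n + x * σ n⌋ - stdNormalDensity x| ≤ E n) :
    ∃ E' : ℕ → ℝ, Tendsto E' atTop (nhds 0) ∧ ∀ᶠ n in atTop, ∀ x : ℝ,
      |(∑ j ∈ Finset.range (M n), if (j : ℝ) ≤ μ n + x * σ n then (Q n).coeff j else 0) -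
        ∫ y in Set.Iic x, stdNormalDensity y| ≤ E' n := by
  have hpos := hσ.eventually_gt_atTop 0
  have hcoeff : ∀ n k, 0 ≤ intCoeff (Q n) k := by
    intro n k
    unfold intCoeff
    split_ifs
    exacts [hQ0 n _, le_rfl]
  have hL1 : Tendsto (fun n => ∫ y, |histogram (Q n) (μ n) (σ n) y - stdNormalDensity y|) atTop
      (nhds 0) := by
    refine tendsto_integral_abs_sub_of_tendsto _ _ ?_ ?_ integrable_stdNormalDensity
      stdNormalDensity_nonneg ?_ fun x => ?_
    · filter_upwards [hpos] with n hn using integrable_histogram _ _ _ hn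
    · filter_upwards [hpos] with n hn x using mul_nonneg hn.le (hcoeff n _)
    · filter_upwards [hpos] with n hn
      rw [integral_histogram _ (hQ1 n) _ _ hn, integral_stdNormalDensity]
    · rw [tendsto_iff_norm_sub_tendsto_zero]
      refine squeeze_zero' (Filter.Eventually.of_forall fun n => norm_nonneg _) ?_ hE
      filter_upwards [hlocal] with n hn using hn x
  refine ⟨fun n => (E n + 1) * (σ n)⁻¹ +
    ∫ y, |histogram (Q n) (μ n) (σ n) y - stdNormalDensity y|, ?_, ?_⟩
  · simpa using ((hE.add_const 1).mul hσ.inv_tendsto_atTop).add hL1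
  · filter_upwards [hpos, hlocal] with n hn hl x
    refine (abs_sub_le _ (∫ y in Set.Iic x, histogram (Q n) (μ n) (σ n) y) _).trans
      (add_le_add ?_ ?_)
    · refine (abs_sum_sub_setIntegral_histogram_le _ (hQ0 n) _ (hM n) _ _ hn x).trans ?_
      rw [← div_eq_mul_inv, le_div_iff₀ hn]
      have := (abs_le.1 (hl x)).2
      linarith [stdNormalDensity_le_one x]
    · have hi := integrable_histogram (Q n) (μ n) (σ n) hn
      rw [← MeasureTheory.integral_sub hi.integrableOn integrable_stdNormalDensity.integrableOn]
      refine (MeasureTheory.abs_integral_le_integral_abs).trans ?_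
      exact MeasureTheory.setIntegral_le_integral (hi.sub integrable_stdNormalDensity).abs
        (Filter.Eventually.of_forall fun y => abs_nonneg _)

/-- The generating polynomial of the Laplacian coefficients of the star on `m + 2` vertices. -/
noncomputable def starPoly (m : ℕ) : ℝ[X] :=
  X * (X + C ((m : ℝ) + 2)) * (X + 1) ^ m

theorem starPoly_coeff (m k : ℕ) :
    (starPoly m).coeff k = (-1) ^ (m + 2 - k) *
      ((completeBipartiteGraph (Fin 1) (Fin (m + 1))).lapMatrix ℝ).charpoly.coeff k := by
  have hcomp : starPoly m = C ((-1) ^ m) *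
      ((completeBipartiteGraph (Fin 1) (Fin (m + 1))).lapMatrix ℝ).charpoly.comp (-X) := by
    rw [charpoly_lapMatrix_star, starPoly]
    simp only [mul_comp, sub_comp, pow_comp, X_comp, C_comp]
    rw [show (-X - C 1 : ℝ[X]) = C (-1) * (X + 1) by simp; ring, mul_pow, ← C_pow]
    have : (C ((-1 : ℝ) ^ m) * C ((-1) ^ m) : ℝ[X]) = 1 := by
      rw [← C_mul, ← mul_pow]
      simp
    linear_combination (-(X * (X + C ((m : ℝ) + 2)) * (X + 1) ^ m)) * this
  rw [hcomp, coeff_C_mul, show (-X : ℝ[X]) = C (-1) * X by simp, comp_C_mul_X_coeff]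
  rcases le_or_gt k (m + 2) with hk | hk
  · obtain ⟨j, hj⟩ := Nat.exists_eq_add_of_le hk
    have hsign : (-1 : ℝ) ^ m * (-1) ^ k = (-1) ^ (m + 2 - k) := by
      rw [hj, Nat.add_sub_cancel_left]
      have h1 : (-1 : ℝ) ^ m = (-1) ^ k * (-1) ^ j := by
        rw [← pow_add, ← hj, pow_add]
        simp
      have h2 : (-1 : ℝ) ^ k * (-1) ^ k = 1 := by
        rw [← mul_pow]
        simp
      linear_combination (-1) ^ k * h1 + (-1) ^ j * h2
    rw [← hsign]
    ring
  · rw [coeff_eq_zero_of_natDegree_lt]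
    · simp
    · rw [Matrix.charpoly_natDegree_eq_dim]
      simpa [add_comm] using by omega

theorem starPoly_coeff_nonneg (m k : ℕ) : 0 ≤ (starPoly m).coeff k := by
  have : starPoly m = (X * (X + C (m + 2)) * (X + 1) ^ m : ℕ[X]).map (Nat.castRingHom ℝ) := by
    simp [starPoly, show (C (2 : ℝ) : ℝ[X]) = 2 from rfl]
  rw [this, coeff_map]
  exact Nat.cast_nonneg _

theorem natDegree_starPoly (m : ℕ) : (starPoly m).natDegree = m + 2 := by
  have h1 : (X + C ((m : ℝ) + 2)) ≠ 0 := X_add_C_ne_zero _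
  have h2 : (X + 1 : ℝ[X]) ≠ 0 := by simpa using X_add_C_ne_zero (1 : ℝ)
  have h3 : (X + 1 : ℝ[X]).natDegree = 1 := by simpa using natDegree_X_add_C (1 : ℝ)
  rw [starPoly, natDegree_mul (mul_ne_zero X_ne_zero h1) (pow_ne_zero _ h2),
    natDegree_mul X_ne_zero h1, natDegree_pow, h3, natDegree_X, natDegree_X_add_C]
  ring

theorem sum_starPoly_coeff (m : ℕ) :
    ∑ k ∈ Finset.range (m + 3), (starPoly m).coeff k = ((m : ℝ) + 3) * 2 ^ m := by
  have h := eval_eq_sum_range (p := starPoly m) 1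
  rw [natDegree_starPoly] at h
  simp only [one_pow, mul_one] at h
  rw [← h, starPoly]
  simp
  ring

/-- The probability generating polynomial of the Laplacian coefficients of the star on `m + 2`
vertices. -/
noncomputable def starPGF (m : ℕ) : ℝ[X] :=
  C ((((m : ℝ) + 3) * 2 ^ m)⁻¹) * starPoly m

theorem standardizedCharFun_starPGF (m : ℕ) (σ s : ℝ) :
    standardizedCharFun (starPGF m) (1 + 1 / (m + 3) + m / 2) σ s =
      Complex.exp (-((s / σ / (m + 3) : ℝ) * Complex.I)) *
      ((Complex.exp ((s / σ : ℝ) * Complex.I) + (m + 2)) / (m + 3)) *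
      ((Real.cos (s / σ / 2) ^ m : ℝ) : ℂ) := by
  unfold standardizedCharFun starPGF starPoly
  set t := s / σ
  have hm : (m : ℂ) + 3 ≠ 0 := by exact_mod_cast (by positivity : ((m : ℝ) + 3) ≠ 0)
  have hcos : Complex.exp (t * Complex.I) + 1 =
      Complex.exp ((t / 2 : ℝ) * Complex.I) * (2 * (Real.cos (t / 2) : ℂ)) := by
    rw [Complex.ofReal_cos, Complex.two_cos, mul_add, ← Complex.exp_add, ← Complex.exp_add]
    push_cast
    ring_nf
    simp [add_comm]
  have hphase : Complex.exp (-(((1 + 1 / (m + 3) + m / 2 : ℝ) : ℂ) * t * Complex.I)) *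
      Complex.exp (t * Complex.I) * Complex.exp ((t / 2 : ℝ) * Complex.I) ^ m =
      Complex.exp (-((t / (m + 3) : ℝ) * Complex.I)) := by
    rw [← Complex.exp_nat_mul, ← Complex.exp_add, ← Complex.exp_add]
    congr 1
    push_cast
    field_simp
    ring
  simp only [Polynomial.map_mul, Polynomial.map_add, Polynomial.map_pow, map_X, map_C,
    Polynomial.map_one, eval_mul, eval_add, eval_pow, eval_X, eval_C, eval_one]
  rw [hcos, mul_pow, ← hphase, mul_pow]
  simp only [Complex.ofRealHom_eq_coe]
  push_cast
  field_simp

theorem norm_standardizedCharFun_starPGF_le (m : ℕ) (σ s : ℝ) :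
    ‖standardizedCharFun (starPGF m) (1 + 1 / (m + 3) + m / 2) σ s‖ ≤
      |Real.cos (s / σ / 2)| ^ m := by
  rw [standardizedCharFun_starPGF, norm_mul, norm_mul, ← neg_mul, ← Complex.ofReal_neg,
    Complex.norm_exp_ofReal_mul_I, one_mul, Complex.norm_real, norm_pow, Real.norm_eq_abs]
  refine mul_le_of_le_one_left (by positivity) ?_
  have hm : ‖(m : ℂ) + 3‖ = m + 3 := by
    exact_mod_cast Complex.norm_natCast (m + 3)
  have hm2 : ‖(m : ℂ) + 2‖ = m + 2 := by
    exact_mod_cast Complex.norm_natCast (m + 2)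
  rw [norm_div, hm, div_le_one (by positivity)]
  refine (norm_add_le _ _).trans ?_
  rw [Complex.norm_exp_ofReal_mul_I, hm2]
  linarith

theorem tendsto_div_sq_of_sq_eq (σ : ℕ → ℝ) (hσ : Tendsto σ atTop atTop)
    (hσ2 : ∀ m : ℕ, σ m ^ 2 = m / 4 + (m + 2) / (m + 3) ^ 2) :
    Tendsto (fun m : ℕ => (m : ℝ) / σ m ^ 2) atTop (nhds 4) := by
  have hinv : Tendsto (fun m => 4 * (σ m ^ 2)⁻¹) atTop (nhds 0) := by
    simpa using (((tendsto_pow_atTop two_ne_zero).comp hσ).inv_tendsto_atTop).const_mul 4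
  rw [tendsto_iff_norm_sub_tendsto_zero]
  refine squeeze_zero' (Filter.Eventually.of_forall fun n => norm_nonneg _) ?_ hinv
  filter_upwards [hσ.eventually_gt_atTop 0] with m hm
  have hle : ((m : ℝ) + 2) / (m + 3) ^ 2 ≤ 1 := by
    rw [div_le_one (by positivity)]
    nlinarith [(Nat.cast_nonneg m : (0 : ℝ) ≤ m)]
  have hge : 0 ≤ ((m : ℝ) + 2) / (m + 3) ^ 2 := by positivity
  have hs : 0 < σ m ^ 2 := by positivity
  have h1 : (m : ℝ) / σ m ^ 2 - 4 = (m - 4 * σ m ^ 2) / σ m ^ 2 := by field_simp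
  rw [h1, norm_div, Real.norm_of_nonneg hs.le, div_eq_mul_inv, Real.norm_eq_abs]
  gcongr
  rw [hσ2, abs_le]
  constructor <;> linarith

theorem tendsto_atTop_of_sq_eq (σ : ℕ → ℝ) (hσ0 : ∀ m, 0 ≤ σ m)
    (hσ2 : ∀ m : ℕ, σ m ^ 2 = m / 4 + (m + 2) / (m + 3) ^ 2) : Tendsto σ atTop atTop := by
  have h : Tendsto (fun m : ℕ => Real.sqrt (m / 4)) atTop atTop :=
    Real.tendsto_sqrt_atTop.comp (tendsto_natCast_atTop_atTop.atTop_div_const (by norm_num))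
  refine tendsto_atTop_mono (fun m => ?_) h
  refine Real.sqrt_le_iff.2 ⟨hσ0 m, ?_⟩
  rw [hσ2]
  have : 0 ≤ ((m : ℝ) + 2) / (m + 3) ^ 2 := by positivity
  linarith

theorem tendsto_cos_pow (σ : ℕ → ℝ) (hσ : Tendsto σ atTop atTop)
    (hratio : Tendsto (fun m : ℕ => (m : ℝ) / σ m ^ 2) atTop (nhds 4)) (s : ℝ) :
    Tendsto (fun m : ℕ => Real.cos (s / σ m / 2) ^ m) atTop (nhds (Real.exp (-s ^ 2 / 2))) := by
  have hu : Tendsto (fun m => s / σ m / 2) atTop (nhds 0) := by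
    simpa using (hσ.const_div_atTop s).div_const 2
  have hmu : Tendsto (fun m : ℕ => (m : ℝ) * (s / σ m / 2) ^ 2) atTop (nhds (s ^ 2)) := by
    convert hratio.mul_const (s ^ 2 / 4) using 2 with m
    · ring
    · ring
  have herr : Tendsto (fun m : ℕ => (m : ℝ) * (Real.cos (s / σ m / 2) - 1) -
      -(m * (s / σ m / 2) ^ 2) / 2) atTop (nhds 0) := by
    have hb : Tendsto (fun m : ℕ => (m : ℝ) * (s / σ m / 2) ^ 2 * (s / σ m / 2) ^ 2) atTop
        (nhds 0) := by
      simpa using hmu.mul (hu.pow 2)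
    refine squeeze_zero_norm' ?_ hb
    have hsmall : ∀ᶠ m in atTop, |s / σ m / 2| ≤ 1 := by
      have := hu.abs
      rw [abs_zero] at this
      exact this.eventually_le_const one_pos
    filter_upwards [hsmall] with m hm
    set u := s / σ m / 2
    have h1 : (m : ℝ) * (Real.cos u - 1) - -(m * u ^ 2) / 2 =
        m * (Real.cos u - (1 - u ^ 2 / 2)) := by ring
    have h2 := Real.cos_bound hm
    have h3 : |u| ^ 4 = u ^ 2 * u ^ 2 := by
      rw [← sq_abs u]
      ring
    rw [h1, norm_mul, Real.norm_natCast, Real.norm_eq_abs, mul_assoc]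
    gcongr
    rw [h3] at h2
    nlinarith [mul_nonneg (sq_nonneg u) (sq_nonneg u)]
  have hmain : Tendsto (fun m : ℕ => (m : ℝ) * (Real.cos (s / σ m / 2) - 1)) atTop
      (nhds (-s ^ 2 / 2)) := by
    simpa using herr.add (hmu.neg.div_const 2)
  simpa using Real.tendsto_one_add_pow_exp_of_tendsto hmain

theorem tendsto_standardizedCharFun_starPGF (σ : ℕ → ℝ) (hσ : Tendsto σ atTop atTop)
    (hratio : Tendsto (fun m : ℕ => (m : ℝ) / σ m ^ 2) atTop (nhds 4)) (s : ℝ) :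
    Tendsto (fun m : ℕ => standardizedCharFun (starPGF m) (1 + 1 / (m + 3) + m / 2) (σ m) s) atTop
      (nhds (Real.exp (-s ^ 2 / 2) : ℝ)) := by
  simp only [standardizedCharFun_starPGF]
  have hden : Tendsto (fun m : ℕ => ((m : ℝ) + 3)⁻¹) atTop (nhds 0) :=
    (tendsto_atTop_add_const_right _ _ tendsto_natCast_atTop_atTop).inv_tendsto_atTop
  have ht : Tendsto (fun m => s / σ m) atTop (nhds 0) := hσ.const_div_atTop s
  have h1 : Tendsto (fun m : ℕ => Complex.exp (-((s / σ m / (m + 3) : ℝ) * Complex.I))) atTop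
      (nhds 1) := by
    have hr : Tendsto (fun m : ℕ => s / σ m / (m + 3)) atTop (nhds 0) := by
      simpa [div_eq_mul_inv] using ht.mul hden
    have hc : Continuous fun r : ℝ => Complex.exp (-((r : ℂ) * Complex.I)) := by fun_prop
    exact (hc.tendsto' 0 1 (by simp)).comp hr
  have h2 : Tendsto (fun m : ℕ => (Complex.exp ((s / σ m : ℝ) * Complex.I) + (m + 2)) /
      ((m : ℂ) + 3)) atTop (nhds 1) := by
    have hc : Continuous fun r : ℝ => Complex.exp ((r : ℂ) * Complex.I) := by fun_prop
    have he : Tendsto (fun m : ℕ => Complex.exp ((s / σ m : ℝ) * Complex.I)) atTop (nhds 1) := by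
      exact (hc.tendsto' 0 1 (by simp)).comp ht
    have hden' : Tendsto (fun m : ℕ => (((((m : ℝ) + 3)⁻¹ : ℝ)) : ℂ)) atTop (nhds 0) := by
      exact (Complex.continuous_ofReal.tendsto' 0 0 (by simp)).comp hden
    have := ((he.sub_const 1).mul hden').add_const 1
    rw [sub_self, mul_zero, zero_add] at this
    refine this.congr fun m => ?_
    have hm : (m : ℂ) + 3 ≠ 0 := by exact_mod_cast (by positivity : ((m : ℝ) + 3) ≠ 0)
    push_cast
    field_simp
    ring
  have h3 := (Complex.continuous_ofReal.tendsto _).comp (tendsto_cos_pow σ hσ hratio s)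
  simpa using (h1.mul h2).mul h3

theorem exists_starPGF_local_limit_error (σ : ℕ → ℝ) (hσ0 : ∀ m, 0 ≤ σ m)
    (hσ2 : ∀ m : ℕ, σ m ^ 2 = m / 4 + (m + 2) / (m + 3) ^ 2) :
    ∃ E : ℕ → ℝ, Tendsto E atTop (nhds 0) ∧ ∀ᶠ m : ℕ in atTop, ∀ x : ℝ,
      |σ m * intCoeff (starPGF m) ⌊(1 + 1 / (m + 3) + m / 2) + x * σ m⌋ - stdNormalDensity x| ≤
        E m := by
  have hσ := tendsto_atTop_of_sq_eq σ hσ0 hσ2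
  have hratio := tendsto_div_sq_of_sq_eq σ hσ hσ2
  refine exists_local_limit_error starPGF (fun m => 1 + 1 / (m + 3) + m / 2) σ hσ
    (tendsto_standardizedCharFun_starPGF σ hσ hratio)
    (fun s => Real.exp (-(1 / Real.pi ^ 2) * s ^ 2)) (integrable_exp_neg_mul_sq (by positivity))
    ?_ fun s => (Real.exp_pos _).le
  filter_upwards [hσ.eventually_gt_atTop 0, hratio.eventually_const_le (by norm_num : (2 : ℝ) < 4)]
    with m hm hm2 s hs
  refine (norm_standardizedCharFun_starPGF_le m (σ m) s).trans ?_
  set u := s / σ m / 2 with hu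
  have hupi : |u| ≤ Real.pi / 2 := by
    rw [hu, abs_div, abs_div, abs_of_pos hm, abs_two]
    gcongr
    rwa [div_le_iff₀ hm]
  have hcos0 : 0 ≤ Real.cos u :=
    Real.cos_nonneg_of_neg_pi_div_two_le_of_le (abs_le.1 hupi).1 (abs_le.1 hupi).2
  have hcos : Real.cos u ≤ Real.exp (-(2 / Real.pi ^ 2 * u ^ 2)) := by
    refine (Real.cos_le_one_sub_mul_cos_sq (hupi.trans (by linarith [Real.pi_pos]))).trans ?_
    linarith [Real.add_one_le_exp (-(2 / Real.pi ^ 2 * u ^ 2))]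
  rw [abs_of_nonneg hcos0]
  refine (pow_le_pow_left₀ hcos0 hcos m).trans ?_
  rw [← Real.exp_nat_mul, Real.exp_le_exp]
  have h1 : (m : ℝ) * -(2 / Real.pi ^ 2 * u ^ 2) =
      -((1 / Real.pi ^ 2) * s ^ 2 * ((m / σ m ^ 2) / 2)) := by
    rw [hu]
    field_simp
  have h2 : 0 ≤ (1 / Real.pi ^ 2) * s ^ 2 := by positivity
  rw [h1]
  nlinarith

theorem tendsto_iSup_abs_of_forall_le (f : ℕ → ℝ → ℝ) (E : ℕ → ℝ)
    (hE : Tendsto E atTop (nhds 0)) (h : ∀ᶠ n in atTop, ∀ x, |f n x| ≤ E n) :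
    Tendsto (fun n => ⨆ x : ℝ, |f n x|) atTop (nhds 0) := by
  refine squeeze_zero' (Filter.Eventually.of_forall fun n => Real.iSup_nonneg fun x =>
    abs_nonneg _) ?_ hE
  filter_upwards [h] with n hn using ciSup_le hn

/-- for the star `K_{1,n-1}`, the mean and variance associated to its
Laplacian eigenvalues are `μ_n = (n²+n+2)/(2(n+1))` and `σ_n² = (n-1)(n²+n+2)/(4(n+1)²)`;
consequently `σ_n → ∞` and the Laplacian coefficients `c(K_{1,n-1},k)` are asymptotically
normal by central and local limit theorems with this mean and variance. -/
theorem star_laplacian_coeffs_asymptotically_normal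
    (N : ℕ → ℕ) (hN : ∀ n, N n = Fintype.card (Fin 1 ⊕ Fin (n - 1)))
    (lam : ∀ n, Fin (N n) → ℝ)
    (hlam : ∀ n, (((completeBipartiteGraph (Fin 1) (Fin (n - 1))).lapMatrix ℝ)).charpoly
      = ∏ i : Fin (N n), (X - C (lam n i)))
    (c : ℕ → ℕ → ℝ)
    (hc : ∀ n k, c n k = (-1 : ℝ) ^ (N n - k) *
      (((completeBipartiteGraph (Fin 1) (Fin (n - 1))).lapMatrix ℝ)).charpoly.coeff k)
    (μ σ : ℕ → ℝ)
    (hμ : ∀ n, μ n = ∑ i : Fin (N n), 1 / (1 + lam n i))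
    (hσ : ∀ n, σ n ^ 2 = ∑ i : Fin (N n), lam n i / (1 + lam n i) ^ 2)
    (hσ0 : ∀ n, 0 ≤ σ n) :
    (∀ n, 2 ≤ n →
      μ n = ((n : ℝ) ^ 2 + n + 2) / (2 * (n + 1)) ∧
      σ n ^ 2 = ((n : ℝ) - 1) * ((n : ℝ) ^ 2 + n + 2) / (4 * ((n : ℝ) + 1) ^ 2))
    ∧ Tendsto σ atTop atTop
    ∧ Tendsto (fun n : ℕ => ⨆ x : ℝ,
        |(∑ k ∈ Finset.range (N n + 1),
            if (k : ℝ) ≤ μ n + x * σ n then c n k / (∑ j ∈ Finset.range (N n + 1), c n j) else 0)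
          - (Real.sqrt (2 * Real.pi))⁻¹ * ∫ t in Set.Iic x, Real.exp (-t ^ 2 / 2)|)
        atTop (nhds 0)
    ∧ Tendsto (fun n : ℕ => ⨆ x : ℝ,
        |σ n * (if 0 ≤ ⌊μ n + x * σ n⌋ then
              c n (⌊μ n + x * σ n⌋).toNat / (∑ j ∈ Finset.range (N n + 1), c n j) else 0)
          - (Real.sqrt (2 * Real.pi))⁻¹ * Real.exp (-x ^ 2 / 2)|)
        atTop (nhds 0) := by
  have hcard : ∀ m : ℕ, N (m + 2) = m + 2 := by
    intro m
    rw [hN]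
    simp
    omega
  have hsum : ∀ (m : ℕ) (f : ℝ → ℝ),
      ∑ i, f (lam (m + 2) i) = f 0 + f ((m : ℝ) + 2) + m * f 1 := fun m =>
    sum_eq_of_prod_X_sub_C_eq (lam (m + 2)) _ m
      ((hlam (m + 2)).symm.trans (charpoly_lapMatrix_star m))
  have hμm : ∀ m : ℕ, μ (m + 2) = 1 + 1 / (m + 3) + m / 2 := by
    intro m
    rw [hμ, hsum m fun l => 1 / (1 + l)]
    ring_nf
  have hσm : ∀ m : ℕ, σ (m + 2) ^ 2 = m / 4 + (m + 2) / (m + 3) ^ 2 := by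
    intro m
    rw [hσ, hsum m fun l => l / (1 + l) ^ 2]
    ring_nf
  have hcm : ∀ m k : ℕ, c (m + 2) k = (starPoly m).coeff k := by
    intro m k
    rw [hc, starPoly_coeff, hcard]
    rfl
  have htotal : ∀ m : ℕ, ∑ j ∈ Finset.range (N (m + 2) + 1), c (m + 2) j =
      ((m : ℝ) + 3) * 2 ^ m := by
    intro m
    simp only [hcm, hcard]
    exact sum_starPoly_coeff m
  have hprob : ∀ m k : ℕ, c (m + 2) k / (∑ j ∈ Finset.range (N (m + 2) + 1), c (m + 2) j) =
      (starPGF m).coeff k := by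
    intro m k
    rw [htotal, hcm, starPGF, coeff_C_mul, div_eq_inv_mul]
  have hpgf : ∀ m : ℕ, (starPGF m).eval 1 = 1 := by
    intro m
    rw [starPGF, eval_mul, eval_C, eval_eq_sum_range, natDegree_starPoly]
    simp only [one_pow, mul_one]
    rw [sum_starPoly_coeff]
    exact inv_mul_cancel₀ (by positivity)
  have hσtop := tendsto_atTop_of_sq_eq (fun m => σ (m + 2)) (fun m => hσ0 _) hσm
  obtain ⟨E, hE, hlocal⟩ := exists_starPGF_local_limit_error (fun m => σ (m + 2))
    (fun m => hσ0 _) hσm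
  obtain ⟨E', hE', hcentral⟩ := exists_central_limit_error starPGF (fun m => m + 3)
    (fun m => 1 + 1 / (m + 3) + m / 2) (fun m => σ (m + 2)) hσtop
    (fun m => ((natDegree_C_mul_le _ _).trans_eq (natDegree_starPoly m)).trans_lt (by omega))
    (fun m j => by
      rw [starPGF, coeff_C_mul]
      exact mul_nonneg (by positivity) (starPoly_coeff_nonneg m j))
    hpgf E hE hlocal
  refine ⟨fun n hn => ?_, (tendsto_add_atTop_iff_nat 2).1 hσtop, (tendsto_add_atTop_iff_nat 2).1 ?_,
    (tendsto_add_atTop_iff_nat 2).1 ?_⟩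
  · obtain ⟨m, rfl⟩ := Nat.exists_eq_add_of_le' hn
    rw [hμm, hσm]
    have h3 : (m : ℝ) + 3 ≠ 0 := by positivity
    have h3' : (m : ℝ) + 2 + 1 ≠ 0 := by positivity
    push_cast
    constructor <;> field_simp <;> ring
  · refine tendsto_iSup_abs_of_forall_le _ E' hE' ?_
    filter_upwards [hcentral] with m hm x
    rw [← MeasureTheory.integral_const_mul]
    simp only [hprob, hμm]
    rw [hcard]
    exact hm x
  · refine tendsto_iSup_abs_of_forall_le _ E hE ?_
    filter_upwards [hlocal] with m hm x
    simp only [hprob, hμm]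
    exact hm x
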